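/- arXiv:1609.01671 — 3 statements merged into one kernel-verified Lean document; each statement's English description precedes it below -/
import Mathlib

section
/- Let q > 0, r > 0, reals 0 ≤ Φ < Φ′, c, c′ ∈ (0,∞), and a < 0. Let W : ℝ → ℝ be nonnegative, Borel measurable, vanish on (−∞,0), satisfy W(z) ≤ c·e^{Φz} for all z ≥ 0 and ∫₀^∞ e^{−Φ′z}W(z)dz = 1/r. Let V : ℝ → ℝ be nonnegative, vanish on (−∞,0), with x ↦ e^{−Φ′x}·V(x) nondecreasing on (0,∞) and converging to c′ as x → ∞. Set W̄(x) := ∫₀ˣ W(y)dy, Z(x) := 1 + q·W̄(x), and Z(x,Φ′) := e^{Φ′x}(1 − r∫₀ˣ e^{−Φ′z}W(z)dz). Then lim_{b→∞} [W̄(b−a) + r·∫₀ᵇ V(b−y)·W̄(y−a) dy] / V(b) = Z̃(−a)/q − r/(q·Φ′), where Z̃(−a) := [r·Z(−a) + q·Z(−a,Φ′)]/Φ′. -/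
open MeasureTheory Filter Set

lemma lapl_aux (p : ℝ) (hp : 0 < p) (w : ℝ → ℝ) (hw : ∀ x, 0 ≤ w x) (hwm : Measurable w)
    (hi : IntegrableOn (fun z => Real.exp (-p * z) * w z) (Ioi 0)) :
    IntegrableOn (fun y => Real.exp (-p * y) * ∫ z in (0:ℝ)..y, w z) (Ioi 0) ∧
    (∫ y in Ioi (0:ℝ), Real.exp (-p * y) * ∫ z in (0:ℝ)..y, w z)
      = (∫ z in Ioi (0:ℝ), Real.exp (-p * z) * w z) / p := by
  set μ := (volume : Measure ℝ).restrict (Ioi 0) with hμ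
  let f : ℝ → ℝ → ℝ := fun z y => (Ioi z).indicator (fun y => Real.exp (-p * y) * w z) y
  have hfnn : ∀ z y, 0 ≤ f z y := fun z y =>
    indicator_nonneg (fun _ _ => mul_nonneg (Real.exp_pos _).le (hw _)) _
  have hfm : Measurable (Function.uncurry f) := by
    have : Function.uncurry f = {x : ℝ × ℝ | x.1 < x.2}.indicator
        (fun x => Real.exp (-p * x.2) * w x.1) := by
      ext ⟨z, y⟩
      simp [f, Function.uncurry, indicator]
    rw [this]
    apply Measurable.indicator
    · exact ((Real.measurable_exp.comp (measurable_snd.const_mul _)).mul (hwm.comp measurable_fst))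
    · exact measurableSet_lt measurable_fst measurable_snd
  have hexp : ∀ z : ℝ, IntegrableOn (fun y => Real.exp (-p * y)) (Ioi z) := fun z =>
    integrableOn_exp_mul_Ioi (by linarith) z
  have hfz : ∀ z ∈ Ioi (0:ℝ), (∫ y, f z y ∂μ) = (Real.exp (-p * z) * w z) / p := by
    intro z hz
    simp only [f]
    rw [integral_indicator measurableSet_Ioi, hμ, Measure.restrict_restrict measurableSet_Ioi,
      inter_eq_left.2 (Ioi_subset_Ioi (le_of_lt hz)), integral_mul_const,
      integral_exp_mul_Ioi (by linarith)]
    field_simp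
  have hfi : Integrable (Function.uncurry f) (μ.prod μ) := by
    rw [integrable_prod_iff hfm.aestronglyMeasurable]
    constructor
    · refine Eventually.of_forall fun z => ?_
      simp only [f, Function.uncurry]
      rw [integrable_indicator_iff measurableSet_Ioi]
      exact ((hexp z).mul_const _).mono_measure
        (Measure.restrict_mono le_rfl Measure.restrict_le_self)
    · have : IntegrableOn (fun z => (Real.exp (-p * z) * w z) / p) (Ioi 0) := hi.div_const p
      refine this.congr_fun (fun z hz => ?_) measurableSet_Ioi
      simp only [Function.uncurry, Real.norm_eq_abs, abs_of_nonneg (hfnn _ _)]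
      exact (hfz z hz).symm
  have hfy : ∀ y ∈ Ioi (0:ℝ), (∫ z, f z y ∂μ) = Real.exp (-p * y) * ∫ z in (0:ℝ)..y, w z := by
    intro y hy
    have : (fun z => f z y) = (Iio y).indicator (fun z => Real.exp (-p * y) * w z) := by
      ext z
      simp [f, indicator]
    rw [this, integral_indicator measurableSet_Iio, hμ, Measure.restrict_restrict measurableSet_Iio,
      integral_const_mul, inter_comm, Ioi_inter_Iio, intervalIntegral.integral_of_le (le_of_lt hy),
      integral_Ioc_eq_integral_Ioo]
  constructor
  · exact IntegrableOn.congr_fun (f := fun y => ∫ z, f z y ∂μ) hfi.integral_prod_right hfy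
      measurableSet_Ioi
  · rw [← setIntegral_congr_fun measurableSet_Ioi hfy, ← integral_integral_swap hfi,
      setIntegral_congr_fun measurableSet_Ioi hfz, integral_div]

lemma conv_aux (U g : ℝ → ℝ) (c' : ℝ) (hU : Monotone U) (hU0 : ∀ x, 0 ≤ U x)
    (hlim : Tendsto U atTop (nhds c')) (hg : IntegrableOn g (Ioi 0)) :
    Tendsto (fun b => ∫ y in Ioi (0:ℝ), U (b - y) * g y) atTop
      (nhds (c' * ∫ y in Ioi (0:ℝ), g y)) := by
  rw [← integral_const_mul]
  refine tendsto_integral_filter_of_dominated_convergence (fun y => c' * ‖g y‖) ?_ ?_ ?_ ?_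
  · refine Eventually.of_forall fun b => ?_
    exact ((hU.measurable.comp (measurable_const.sub measurable_id)).aestronglyMeasurable).mul
      hg.aestronglyMeasurable
  · refine Eventually.of_forall fun b => Eventually.of_forall fun y => ?_
    rw [norm_mul, Real.norm_eq_abs, abs_of_nonneg (hU0 _)]
    exact mul_le_mul_of_nonneg_right (hU.ge_of_tendsto hlim _) (norm_nonneg _)
  · exact hg.norm.const_mul _
  · refine Eventually.of_forall fun y => ?_
    refine Tendsto.mul_const _ (hlim.comp ?_)
    exact tendsto_atTop_add_const_right _ (-y) tendsto_id


/-- Lemma B.1(iv), convergence of `W̄_a^{(q,r)}(b)/W^{(q+r)}(b)` as `b → ∞`. -/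
theorem stmt_5 (q r Φ Φ' c c' a : ℝ) (hq : 0 < q) (hr : 0 < r)
    (hΦ : 0 ≤ Φ) (hΦΦ' : Φ < Φ') (hc : 0 < c) (hc' : 0 < c') (ha : a < 0)
    (W V : ℝ → ℝ) (hWnn : ∀ x, 0 ≤ W x) (hWm : Measurable W)
    (hW0 : ∀ x < 0, W x = 0)
    (hWbound : ∀ z ≥ (0:ℝ), W z ≤ c * Real.exp (Φ * z))
    (hWlap : (∫ z in Set.Ioi (0:ℝ), Real.exp (-Φ' * z) * W z) = 1 / r)
    (hVnn : ∀ x, 0 ≤ V x) (hV0 : ∀ x < 0, V x = 0)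
    (hVmono : MonotoneOn (fun x => Real.exp (-Φ' * x) * V x) (Set.Ioi 0))
    (hVlim : Tendsto (fun x => Real.exp (-Φ' * x) * V x) atTop (nhds c'))
    (Wbar Z ZΦ' : ℝ → ℝ)
    (hWbar : ∀ x, Wbar x = ∫ y in (0:ℝ)..x, W y)
    (hZ : ∀ x, Z x = 1 + q * Wbar x)
    (hZΦ' : ∀ x, ZΦ' x
      = Real.exp (Φ' * x) * (1 - r * ∫ z in (0:ℝ)..x, Real.exp (-Φ' * z) * W z)) :
    Tendsto (fun b => (Wbar (b - a) + r * ∫ y in (0:ℝ)..b, V (b - y) * Wbar (y - a)) / V b)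
      atTop (nhds ((r * Z (-a) + q * ZΦ' (-a)) / Φ' / q - r / (q * Φ'))) := by
  have hp : 0 < Φ' := lt_of_le_of_lt hΦ hΦΦ'
  have hbd : ∀ z, W z ≤ c * Real.exp (Φ * z) := by
    intro z
    rcases lt_or_ge z 0 with h | h
    · rw [hW0 z h]; positivity
    · exact hWbound z h
  have hWii : ∀ x y : ℝ, IntervalIntegrable W volume x y := by
    intro x y
    have h : IntervalIntegrable (fun z => c * Real.exp (Φ * z)) volume x y :=
      Continuous.intervalIntegrable (by fun_prop) _ _
    refine h.mono_fun hWm.aestronglyMeasurable (Eventually.of_forall fun z => ?_)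
    simp only [Real.norm_eq_abs]
    rw [abs_of_nonneg (hWnn z), abs_of_nonneg (by positivity)]
    exact hbd z
  have hLI : IntegrableOn (fun z => Real.exp (-Φ' * z) * W z) (Ioi 0) := by
    refine Integrable.mono' (g := fun z => c * Real.exp ((Φ - Φ') * z))
      ((integrableOn_exp_mul_Ioi (by linarith) 0).const_mul c) ?_ ?_
    · exact ((Real.measurable_exp.comp (measurable_id.const_mul _)).mul hWm).aestronglyMeasurable
    · refine Eventually.of_forall fun z => ?_
      rw [Real.norm_eq_abs, abs_of_nonneg (mul_nonneg (Real.exp_pos _).le (hWnn z))]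
      calc Real.exp (-Φ' * z) * W z ≤ Real.exp (-Φ' * z) * (c * Real.exp (Φ * z)) :=
            mul_le_mul_of_nonneg_left (hbd z) (Real.exp_pos _).le
        _ = c * Real.exp ((Φ - Φ') * z) := by
            rw [mul_left_comm, ← Real.exp_add]; congr 2; ring
  set α := -a with hα
  have hα0 : 0 < α := by linarith
  have hshift : ∀ z, Real.exp (-Φ' * z) * W (z + α)
      = Real.exp (Φ' * α) * (Real.exp (-Φ' * (z + α)) * W (z + α)) := by
    intro z
    rw [← mul_assoc, ← Real.exp_add]; congr 2; ring
  have hLIα : IntegrableOn (fun z => Real.exp (-Φ' * z) * W z) (Ioi α) :=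
    hLI.mono_set (Ioi_subset_Ioi hα0.le)
  have hcomp : IntegrableOn (fun z => Real.exp (-Φ' * (z + α)) * W (z + α)) (Ioi 0) := by
    have := ((measurePreserving_add_right volume α).integrableOn_comp_preimage
      (measurableEmbedding_addRight α)).2 hLIα
    rw [preimage_add_const_Ioi, sub_self] at this
    exact this
  have hLIs : IntegrableOn (fun z => Real.exp (-Φ' * z) * W (z + α)) (Ioi 0) := by
    simp_rw [hshift]
    exact hcomp.const_mul _
  obtain ⟨hI1, hI2⟩ := lapl_aux Φ' hp (fun z => W (z + α)) (fun _ => hWnn _)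
    (hWm.comp (measurable_id.add_const α)) hLIs
  have hWb : ∀ y, Wbar (y + α) = Wbar α + ∫ z in (0:ℝ)..y, W (z + α) := by
    intro y
    rw [hWbar, hWbar, intervalIntegral.integral_comp_add_right, zero_add,
      intervalIntegral.integral_add_adjacent_intervals (hWii _ _) (hWii _ _)]
  have hval : (∫ z in Ioi (0:ℝ), Real.exp (-Φ' * z) * W (z + α)) = ZΦ' α / r := by
    simp_rw [hshift]
    have h0 := (measurePreserving_add_right volume α).setIntegral_preimage_emb
      (measurableEmbedding_addRight α) (fun z => Real.exp (-Φ' * z) * W z) (Ioi α)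
    rw [preimage_add_const_Ioi, sub_self] at h0
    rw [integral_const_mul, h0, hZΦ']
    have h1 := intervalIntegral.integral_interval_add_Ioi' (a := 0) (b := α)
      (f := fun z => Real.exp (-Φ' * z) * W z) (μ := volume)
      ((intervalIntegrable_iff_integrableOn_Ioc_of_le hα0.le).2
        (hLI.mono_set Ioc_subset_Ioi_self)) hLIα
    rw [hWlap] at h1
    have h2 : (∫ z in Ioi α, Real.exp (-Φ' * z) * W z)
      = 1 / r - ∫ z in (0:ℝ)..α, Real.exp (-Φ' * z) * W z := by linarith
    rw [h2]; field_simp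
  set g : ℝ → ℝ := fun y => Real.exp (-Φ' * y) * Wbar (y + α) with hg
  have hgeq : g = fun y => Real.exp (-Φ' * y) * Wbar α
      + Real.exp (-Φ' * y) * ∫ z in (0:ℝ)..y, W (z + α) := by
    ext y; simp only [hg]; rw [hWb, mul_add]
  have hE : IntegrableOn (fun y => Real.exp (-Φ' * y) * Wbar α) (Ioi 0) :=
    (integrableOn_exp_mul_Ioi (by linarith) 0).mul_const _
  have hgi : IntegrableOn g (Ioi 0) := by rw [hgeq]; exact hE.add hI1
  have hgv : (∫ y in Ioi (0:ℝ), g y) = Wbar α / Φ' + ZΦ' α / r / Φ' := by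
    rw [hgeq, integral_add hE hI1, hI2, hval, integral_mul_const,
      integral_exp_mul_Ioi (by linarith)]
    simp; field_simp
  set U : ℝ → ℝ := (Ioi 0).indicator (fun x => Real.exp (-Φ' * x) * V x) with hUd
  have hU0 : ∀ x, 0 ≤ U x := fun x =>
    indicator_nonneg (fun _ _ => mul_nonneg (Real.exp_pos _).le (hVnn _)) _
  have hUpos : ∀ x, 0 < x → U x = Real.exp (-Φ' * x) * V x := fun x hx =>
    indicator_of_mem (show x ∈ Ioi 0 from hx) _
  have hUneg : ∀ x, x ≤ 0 → U x = 0 := fun x hx =>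
    indicator_of_notMem (fun h => not_lt.2 hx h) _
  have hUm : Monotone U := by
    intro x y hxy
    rcases le_or_gt x 0 with hx | hx
    · rw [hUneg x hx]; exact hU0 y
    · rw [hUpos x hx, hUpos y (hx.trans_le hxy)]
      exact hVmono hx (hx.trans_le hxy) hxy
  have hUlim : Tendsto U atTop (nhds c') := by
    refine hVlim.congr' ?_
    filter_upwards [eventually_gt_atTop 0] with x hx
    exact (hUpos x hx).symm
  have hconv := conv_aux U g c' hUm hU0 hUlim hgi
  have hfirst : Tendsto (fun b => Real.exp (-Φ' * b) * Wbar (b + α)) atTop (nhds 0) := by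
    have hlim : Tendsto (fun b : ℝ => (c * Real.exp (Φ' * α)) *
        ((b + α) ^ 1 * Real.exp (-(Φ' - Φ) * (b + α)))) atTop (nhds 0) := by
      have h1 : Tendsto (fun x : ℝ => x ^ 1 * Real.exp (-(Φ' - Φ) * x)) atTop (nhds 0) := by
        have h := (isLittleO_pow_exp_pos_mul_atTop 1 (sub_pos.2 hΦΦ')).tendsto_div_nhds_zero
        refine h.congr fun x => ?_
        rw [neg_mul, Real.exp_neg]; rfl
      have h2 := (h1.comp (tendsto_atTop_add_const_right atTop α tendsto_id)).const_mul
        (c * Real.exp (Φ' * α))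
      rw [mul_zero] at h2
      exact h2
    refine squeeze_zero' ?_ ?_ hlim
    · filter_upwards [eventually_gt_atTop 0] with b hb
      rw [hWbar]
      exact mul_nonneg (Real.exp_pos _).le
        (intervalIntegral.integral_nonneg (by linarith) fun _ _ => hWnn _)
    · filter_upwards [eventually_gt_atTop 0] with b hb
      have hle : Wbar (b + α) ≤ (b + α) * (c * Real.exp (Φ * (b + α))) := by
        rw [hWbar]
        have : (∫ y in (0:ℝ)..(b + α), W y)
            ≤ ∫ y in (0:ℝ)..(b + α), c * Real.exp (Φ * (b + α)) := by
          refine intervalIntegral.integral_mono_on (by linarith) (hWii _ _)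
            intervalIntegrable_const fun x hx => (hbd x).trans ?_
          have := mul_le_mul_of_nonneg_left hx.2 hΦ
          gcongr
        rw [intervalIntegral.integral_const, smul_eq_mul, sub_zero] at this
        exact this
      calc Real.exp (-Φ' * b) * Wbar (b + α)
          ≤ Real.exp (-Φ' * b) * ((b + α) * (c * Real.exp (Φ * (b + α)))) :=
            mul_le_mul_of_nonneg_left hle (Real.exp_pos _).le
        _ = c * (b + α) * (Real.exp (-Φ' * b) * Real.exp (Φ * (b + α))) := by ring
        _ = c * (b + α) * (Real.exp (Φ' * α) * Real.exp (-(Φ' - Φ) * (b + α))) := by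
            rw [← Real.exp_add, ← Real.exp_add]; congr 2; ring
        _ = _ := by ring
  have hfinal := (hfirst.add (hconv.const_mul r)).div hUlim hc'.ne'
  have htarget : (0 + r * (c' * ∫ y in Ioi (0:ℝ), g y)) / c'
      = (r * Z α + q * ZΦ' α) / Φ' / q - r / (q * Φ') := by
    rw [hgv, hZ]; field_simp; ring
  rw [htarget] at hfinal
  refine hfinal.congr' ?_
  filter_upwards [eventually_gt_atTop 0] with b hb
  have hint : (∫ y in Ioi (0:ℝ), U (b - y) * g y)
      = Real.exp (-Φ' * b) * ∫ y in (0:ℝ)..b, V (b - y) * Wbar (y - a) := by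
    rw [intervalIntegral.integral_of_le hb.le, integral_Ioc_eq_integral_Ioo,
      ← integral_const_mul]
    rw [setIntegral_eq_of_subset_of_forall_sdiff_eq_zero measurableSet_Ioi
      (show Ioo 0 b ⊆ Ioi (0:ℝ) from fun y hy => hy.1)]
    · refine setIntegral_congr_fun measurableSet_Ioo fun y hy => ?_
      have h1 : (0:ℝ) < b - y := by linarith [hy.2]
      have h2 : y - a = y + α := by rw [hα]; ring
      have h3 : Real.exp (-Φ' * b) = Real.exp (-Φ' * (b - y)) * Real.exp (-Φ' * y) := by
        rw [← Real.exp_add]; congr 1; ring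
      simp only [hg]
      rw [hUpos _ h1, h2, h3]; ring
    · intro y hy
      have : b ≤ y := by
        by_contra h
        exact hy.2 ⟨hy.1, not_le.1 h⟩
      rw [hUneg _ (by linarith), zero_mul]
  have h2 : b - a = b + α := by rw [hα]; ring
  simp only [Pi.div_apply]
  rw [hint, hUpos b hb, h2, mul_left_comm, ← mul_add,
    mul_div_mul_left _ _ (Real.exp_pos _).ne']
end

section
/- Let q ≥ 0, r > 0, Φ′ > 0, c′ ∈ (0,∞), and a < 0. Let W, V : ℝ → ℝ be nonnegative, locally integrable, vanish on (−∞,0), with x ↦ e^{−Φ′x}·V(x) nondecreasing on (0,∞) and converging to c′ as x → ∞. Set W̄(x):=∫₀ˣW, Z(x):=1+q·W̄(x), Z̄(x):=∫₀ˣZ, V̄(x):=∫₀ˣV, Z_V(x):=1+(q+r)·V̄(x), Z̄_V(x):=∫₀ˣZ_V, and Z(x,Φ′):=e^{Φ′x}(1−r∫₀ˣ e^{−Φ′z}W(z)dz). Assume the representation Z̄(x−a) + r∫₀ˣ V(x−y)Z̄(y−a)dy = Z̄_V(x−a) − r∫₀^{−a} V(x−u−a)·Z̄(u) du holds for all x ≥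 0. Then lim_{b→∞} [Z̄(b−a) + r∫₀ᵇ V(b−y)Z̄(y−a)dy] / V(b) = [r·Z̄(−a) + Z̃(−a)]/Φ′, where Z̃(−a) := [r·Z(−a) + q·Z(−a,Φ′)]/Φ′. -/
open MeasureTheory Filter Set

lemma aux_ii {f : ℝ → ℝ} (hf : LocallyIntegrable f volume) (x y : ℝ) :
    IntervalIntegrable f volume x y :=
  intervalIntegrable_iff.mpr <|
      (hf.integrableOn_isCompact isCompact_uIcc).mono_set uIoc_subset_uIcc

lemma aux_parts {f : ℝ → ℝ} (hf : LocallyIntegrable f volume) {p : ℝ} (hp : 0 < p) (A : ℝ) :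
    ∫ u in (0:ℝ)..A, Real.exp (-p * u) * (∫ v in (0:ℝ)..u, f v)
      = (-(Real.exp (-p * A) * ∫ v in (0:ℝ)..A, f v)
          + ∫ u in (0:ℝ)..A, Real.exp (-p * u) * f u) / p := by
  have h1 : AbsolutelyContinuousOnInterval (fun u : ℝ => Real.exp (-p * u)) 0 A := by
    apply ContDiffOn.absolutelyContinuousOnInterval
    apply ContDiff.contDiffOn
    fun_prop
  have h2 := (aux_ii hf 0 A).absolutelyContinuousOnInterval_intervalIntegral
    (c := 0) (by simp)
  have h3 := h1.integral_mul_deriv_eq_deriv_mul h2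
  have h4 : ∫ u in (0:ℝ)..A, Real.exp (-p * u) * deriv (fun x ↦ ∫ v in (0:ℝ)..x, f v) u
      = ∫ u in (0:ℝ)..A, Real.exp (-p * u) * f u := by
    apply intervalIntegral.integral_congr_ae
    filter_upwards [LocallyIntegrable.ae_hasDerivAt_integral hf] with x hx _
    rw [(hx 0).deriv]
  have h5 : ∀ u : ℝ, deriv (fun u : ℝ => Real.exp (-p * u)) u = -p * Real.exp (-p * u) := by
    intro u
    have : HasDerivAt (fun u : ℝ => Real.exp (-p * u)) (Real.exp (-p * u) * (-p * 1)) u :=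
      ((hasDerivAt_id u).const_mul (-p)).exp
    rw [this.deriv]; ring
  rw [h4] at h3
  simp only [h5, mul_assoc, intervalIntegral.integral_const_mul, intervalIntegral.integral_same] at h3
  rw [eq_div_iff hp.ne', h3]
  ring

lemma aux_repr {f : ℝ → ℝ} {p : ℝ} {x : ℝ} (hx : 0 < x) :
    Real.exp (-p * x) * ∫ y in (0:ℝ)..x, f y
      = ∫ t in Ioi (0:ℝ), (Iio x).indicator (fun t => Real.exp (-p * x) * f (x - t)) t := by
  have : ∫ y in (0:ℝ)..x, f y = ∫ t in (0:ℝ)..x, f (x - t) := by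
    rw [intervalIntegral.integral_comp_sub_left]; simp
  rw [this, ← intervalIntegral.integral_const_mul, intervalIntegral.integral_of_le hx.le,
    integral_Ioc_eq_integral_Ioo, setIntegral_indicator measurableSet_Iio, Ioi_inter_Iio]

lemma aux_bd {f : ℝ → ℝ} {p B : ℝ}
    (hB : ∀ y > 0, |Real.exp (-p * y) * f y| ≤ B) {x t : ℝ} (ht : t < x) :
    |Real.exp (-p * x) * f (x - t)| ≤ B * Real.exp (-p * t) := by
  have := hB (x - t) (by linarith)
  have e : Real.exp (-p * x) * f (x - t)
      = (Real.exp (-p * (x-t)) * f (x - t)) * Real.exp (-p * t) := by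
    have : Real.exp (-p * x) = Real.exp (-p * (x-t)) * Real.exp (-p * t) := by
      rw [← Real.exp_add]; ring_nf
    rw [this]; ring
  rw [e, abs_mul, abs_of_pos (Real.exp_pos (-p * t))]
  gcongr

lemma aux_bd2 {f : ℝ → ℝ} {p B : ℝ} (hB0 : 0 ≤ B)
    (hB : ∀ y > 0, |Real.exp (-p * y) * f y| ≤ B) (x t : ℝ) :
    ‖(Iio x).indicator (fun t => Real.exp (-p * x) * f (x - t)) t‖ ≤ B * Real.exp (-p * t) := by
  by_cases h : t < x
  · rw [indicator_of_mem (by exact h)]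
    exact aux_bd hB h
  · rw [indicator_of_notMem (by exact h)]
    simp; positivity

lemma aux_bound {f : ℝ → ℝ} {p B : ℝ} (hp : 0 < p) (hB0 : 0 ≤ B)
    (hB : ∀ y > 0, |Real.exp (-p * y) * f y| ≤ B) :
    ∀ x > 0, |Real.exp (-p * x) * ∫ y in (0:ℝ)..x, f y| ≤ B / p := by
  intro x hx
  rw [aux_repr hx]
  have := norm_integral_le_of_norm_le ((exp_neg_integrableOn_Ioi 0 hp).const_mul B)
    (Eventually.of_forall (fun t => aux_bd2 hB0 hB x t))
  refine this.trans (le_of_eq ?_)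
  rw [integral_const_mul, integral_exp_mul_Ioi (by linarith)]
  simp [div_eq_mul_inv]

lemma aux_lim {f : ℝ → ℝ} (hf : LocallyIntegrable f volume) {p B c : ℝ} (hp : 0 < p) (hB0 : 0 ≤ B)
    (hB : ∀ y > 0, |Real.exp (-p * y) * f y| ≤ B)
    (hl : Tendsto (fun x => Real.exp (-p * x) * f x) atTop (nhds c)) :
    Tendsto (fun x => Real.exp (-p * x) * ∫ y in (0:ℝ)..x, f y) atTop (nhds (c / p)) := by
  have key : Tendsto (fun x => ∫ t in Ioi (0:ℝ),
      (Iio x).indicator (fun t => Real.exp (-p * x) * f (x - t)) t) atTop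
      (nhds (∫ t in Ioi (0:ℝ), c * Real.exp (-p * t))) := by
    refine tendsto_integral_filter_of_dominated_convergence (fun t => B * Real.exp (-p * t))
      ?_ ?_ ((exp_neg_integrableOn_Ioi 0 hp).const_mul B) ?_
    · refine Eventually.of_forall (fun x => ?_)
      refine AEStronglyMeasurable.indicator ?_ measurableSet_Iio
      refine AEStronglyMeasurable.const_mul ?_ _
      refine AEStronglyMeasurable.restrict ?_
      exact hf.aestronglyMeasurable.comp_measurePreserving
        (Measure.measurePreserving_sub_left volume x)
    · exact Eventually.of_forall (fun x => Eventually.of_forall (fun t => aux_bd2 hB0 hB x t))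
    · refine Eventually.of_forall (fun t => ?_)
      have h1 : Tendsto (fun x : ℝ => x - t) atTop atTop := tendsto_atTop_add_const_right _ _ tendsto_id
      refine Tendsto.congr' ?_ ((hl.comp h1).mul_const (Real.exp (-p * t)))
      filter_upwards [eventually_gt_atTop t] with x hx
      rw [indicator_of_mem (by exact hx)]
      have : Real.exp (-p * x) = Real.exp (-p * (x-t)) * Real.exp (-p * t) := by
        rw [← Real.exp_add]; ring_nf
      simp only [Function.comp]
      rw [this]; ring
  have e : ∫ t in Ioi (0:ℝ), c * Real.exp (-p * t) = c / p := by
    rw [integral_const_mul, integral_exp_mul_Ioi (by linarith)]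
    simp [div_eq_mul_inv]
  rw [e] at key
  refine key.congr' ?_
  filter_upwards [eventually_gt_atTop 0] with x hx
  rw [aux_repr hx]



/-- Lemma B.1(v), convergence of `Z̄_a^{(q,r)}(b)/W^{(q+r)}(b)` as `b → ∞`. -/
theorem stmt_6 (q r Φ' c' a : ℝ) (hq : 0 ≤ q) (hr : 0 < r) (hΦ' : 0 < Φ')
    (hc' : 0 < c') (ha : a < 0)
    (W V : ℝ → ℝ) (hWnn : ∀ x, 0 ≤ W x) (hVnn : ∀ x, 0 ≤ V x)
    (hWli : LocallyIntegrable W volume) (hVli : LocallyIntegrable V volume)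
    (hW0 : ∀ x < 0, W x = 0) (hV0 : ∀ x < 0, V x = 0)
    (hVmono : MonotoneOn (fun x => Real.exp (-Φ' * x) * V x) (Set.Ioi 0))
    (hVlim : Tendsto (fun x => Real.exp (-Φ' * x) * V x) atTop (nhds c'))
    (Wbar Z Zbar Vbar ZV ZVbar ZΦ' : ℝ → ℝ)
    (hWbar : ∀ x, Wbar x = ∫ y in (0:ℝ)..x, W y)
    (hZ : ∀ x, Z x = 1 + q * Wbar x)
    (hZbar : ∀ x, Zbar x = ∫ y in (0:ℝ)..x, Z y)
    (hVbar : ∀ x, Vbar x = ∫ y in (0:ℝ)..x, V y)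
    (hZV : ∀ x, ZV x = 1 + (q + r) * Vbar x)
    (hZVbar : ∀ x, ZVbar x = ∫ y in (0:ℝ)..x, ZV y)
    (hZΦ' : ∀ x, ZΦ' x
      = Real.exp (Φ' * x) * (1 - r * ∫ z in (0:ℝ)..x, Real.exp (-Φ' * z) * W z))
    (hrep : ∀ x ≥ (0:ℝ),
      Zbar (x - a) + r * ∫ y in (0:ℝ)..x, V (x - y) * Zbar (y - a)
        = ZVbar (x - a) - r * ∫ u in (0:ℝ)..(-a), V (x - u - a) * Zbar u) :
    Tendsto (fun b => (Zbar (b - a) + r * ∫ y in (0:ℝ)..b, V (b - y) * Zbar (y - a)) / V b)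
      atTop (nhds ((r * Zbar (-a) + (r * Z (-a) + q * ZΦ' (-a)) / Φ') / Φ')) := by
  have cont : ∀ {f : ℝ → ℝ}, LocallyIntegrable f volume →
      Continuous (fun x => ∫ y in (0:ℝ)..x, f y) := fun hf =>
    intervalIntegral.continuous_primitive (aux_ii hf) 0
  have hWbarc : Continuous Wbar := by rw [funext hWbar]; exact cont hWli
  have hZc : Continuous Z := by rw [funext hZ]; fun_prop
  have hZbarc : Continuous Zbar := by rw [funext hZbar]; exact cont hZc.locallyIntegrable
  have hVbarc : Continuous Vbar := by rw [funext hVbar]; exact cont hVli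
  have hZVc : Continuous ZV := by rw [funext hZV]; fun_prop
  -- bounds
  have hVle : ∀ y > 0, Real.exp (-Φ' * y) * V y ≤ c' := by
    intro y hy
    refine ge_of_tendsto hVlim ?_
    filter_upwards [eventually_ge_atTop y] with x hx
    exact hVmono hy (lt_of_lt_of_le hy hx) hx
  have hVb : ∀ y > 0, |Real.exp (-Φ' * y) * V y| ≤ c' := by
    intro y hy
    rw [abs_of_nonneg (mul_nonneg (Real.exp_pos _).le (hVnn y))]
    exact hVle y hy
  have hVbarb := aux_bound hΦ' hc'.le hVb
  have hVbarl := aux_lim hVli hΦ' hc'.le hVb hVlim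
  simp only [← hVbar] at hVbarb hVbarl
  have hexp : Tendsto (fun x : ℝ => Real.exp (-Φ' * x)) atTop (nhds 0) :=
    Real.tendsto_exp_atBot.comp (tendsto_id.const_mul_atTop_of_neg (by linarith))
  have hZVl : Tendsto (fun x => Real.exp (-Φ' * x) * ZV x) atTop
      (nhds ((q + r) * (c' / Φ'))) := by
    have := hexp.add (hVbarl.const_mul (q + r))
    rw [zero_add] at this
    refine this.congr (fun x => ?_)
    rw [hZV]; ring
  have hZVb : ∀ y > 0, |Real.exp (-Φ' * y) * ZV y| ≤ 1 + (q + r) * (c' / Φ') := by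
    intro y hy
    have e : Real.exp (-Φ' * y) * ZV y
        = Real.exp (-Φ' * y) + (q + r) * (Real.exp (-Φ' * y) * Vbar y) := by rw [hZV]; ring
    rw [e]
    refine (abs_add_le _ _).trans (add_le_add ?_ ?_)
    · rw [abs_of_pos (Real.exp_pos _), Real.exp_le_one_iff]
      nlinarith
    · rw [abs_mul, abs_of_nonneg (by linarith : 0 ≤ q + r)]
      exact mul_le_mul_of_nonneg_left (hVbarb y hy) (by linarith)
  have hZVbarl := aux_lim hZVc.locallyIntegrable hΦ' (by positivity) hZVb hZVl
  simp only [← hZVbar] at hZVbarl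
  have hshift : Tendsto (fun x : ℝ => x - a) atTop atTop :=
    tendsto_atTop_add_const_right _ _ tendsto_id
  have hT1 : Tendsto (fun b => Real.exp (-Φ' * b) * ZVbar (b - a)) atTop
      (nhds (Real.exp (Φ' * -a) * ((q + r) * (c' / Φ') / Φ'))) := by
    refine ((hZVbarl.comp hshift).const_mul (Real.exp (Φ' * -a))).congr (fun b => ?_)
    simp only [Function.comp]
    rw [← mul_assoc, ← Real.exp_add]; ring_nf
  have hT2 : Tendsto (fun b => ∫ u in (0:ℝ)..(-a), Real.exp (-Φ' * b) * (V (b - u - a) * Zbar u))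
      atTop (nhds (∫ u in (0:ℝ)..(-a),
        (c' * Real.exp (Φ' * -a)) * (Real.exp (-Φ' * u) * Zbar u))) := by
    have e : ∀ b u, Real.exp (-Φ' * b) * (V (b - u - a) * Zbar u)
        = ((Real.exp (-Φ' * (b - u - a)) * V (b - u - a)) * Real.exp (Φ' * -a))
          * (Real.exp (-Φ' * u) * Zbar u) := by
      intro b u
      have : Real.exp (-Φ' * b)
          = Real.exp (-Φ' * (b - u - a)) * Real.exp (Φ' * -a) * Real.exp (-Φ' * u) := by
        rw [← Real.exp_add, ← Real.exp_add]; ring_nf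
      rw [this]; ring
    refine intervalIntegral.tendsto_integral_filter_of_dominated_convergence
      (fun u => |(c' * Real.exp (Φ' * -a)) * (Real.exp (-Φ' * u) * Zbar u)|) ?_ ?_ ?_ ?_
    · refine Eventually.of_forall (fun b => ?_)
      refine AEStronglyMeasurable.const_mul ?_ _
      refine AEStronglyMeasurable.mul ?_ hZbarc.aestronglyMeasurable
      refine AEStronglyMeasurable.restrict ?_
      have := hVli.aestronglyMeasurable.comp_measurePreserving
        (Measure.measurePreserving_sub_left volume (b - a))
      refine this.congr (Eventually.of_forall (fun u => ?_))
      simp only [Function.comp]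
      congr 1; ring
    · filter_upwards [eventually_gt_atTop 0] with b hb
      refine Eventually.of_forall (fun u hu => ?_)
      rw [uIoc_of_le (by linarith)] at hu
      have hpos : 0 < b - u - a := by linarith [hu.2]
      rw [e, Real.norm_eq_abs, abs_mul, abs_mul (c' * _)]
      refine mul_le_mul_of_nonneg_right ?_ (abs_nonneg _)
      rw [abs_mul, abs_mul c', abs_of_pos hc']
      exact mul_le_mul_of_nonneg_right (hVb _ hpos) (abs_nonneg _)
    · apply Continuous.intervalIntegrable
      fun_prop
    · refine Eventually.of_forall (fun u hu => ?_)
      simp only [e]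
      refine Tendsto.mul_const _ (Tendsto.mul_const _ ?_)
      refine hVlim.comp (?_ : Tendsto (fun b : ℝ => b - u - a) atTop atTop)
      exact hshift.comp (tendsto_atTop_add_const_right _ (-u) tendsto_id)
  have hI1 := aux_parts hZc.locallyIntegrable hΦ' (-a)
  simp only [← hZbar] at hI1
  have hI2 := aux_parts hWli hΦ' (-a)
  simp only [← hWbar] at hI2
  have hI3 : ∫ u in (0:ℝ)..(-a), Real.exp (-Φ' * u) = (1 - Real.exp (-Φ' * -a)) / Φ' := by
    rw [intervalIntegral.integral_comp_mul_left (fun x => Real.exp x) (by linarith : -Φ' ≠ 0),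
      integral_exp]
    simp only [smul_eq_mul, mul_zero, Real.exp_zero]
    field_simp
    ring
  have hI4 : ∫ u in (0:ℝ)..(-a), Real.exp (-Φ' * u) * Z u
      = (∫ u in (0:ℝ)..(-a), Real.exp (-Φ' * u))
        + q * ∫ u in (0:ℝ)..(-a), Real.exp (-Φ' * u) * Wbar u := by
    rw [← intervalIntegral.integral_const_mul, ← intervalIntegral.integral_add]
    · refine intervalIntegral.integral_congr (fun u _ => ?_)
      simp only [hZ]; ring
    · apply Continuous.intervalIntegrable; fun_prop
    · apply Continuous.intervalIntegrable; fun_prop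
  rw [intervalIntegral.integral_const_mul, hI1, hI4, hI2, hI3] at hT2
  have hfin := (hT1.sub (hT2.const_mul r)).div hVlim hc'.ne'
  have hval : (Real.exp (Φ' * -a) * ((q + r) * (c' / Φ') / Φ') -
      r * (c' * Real.exp (Φ' * -a) * ((-(Real.exp (-Φ' * -a) * Zbar (-a)) +
        ((1 - Real.exp (-Φ' * -a)) / Φ' + q * ((-(Real.exp (-Φ' * -a) * Wbar (-a)) +
          ∫ u in (0:ℝ)..(-a), Real.exp (-Φ' * u) * W u) / Φ'))) / Φ'))) / c'
      = (r * Zbar (-a) + (r * Z (-a) + q * ZΦ' (-a)) / Φ') / Φ' := by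
    rw [hZ, hZΦ']
    have hm : Real.exp (-Φ' * -a) = (Real.exp (Φ' * -a))⁻¹ := by
      rw [← Real.exp_neg]; ring_nf
    rw [hm]
    have hE : Real.exp (Φ' * -a) ≠ 0 := (Real.exp_pos _).ne'
    generalize Real.exp (Φ' * -a) = E at hE
    generalize (∫ u in (0:ℝ)..(-a), Real.exp (-Φ' * u) * W u) = I
    field_simp
    ring
  rw [hval] at hfin
  refine hfin.congr' ?_
  filter_upwards [eventually_ge_atTop 0] with b hb
  simp only [Pi.div_apply]
  rw [hrep b hb, intervalIntegral.integral_const_mul,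
    ← mul_div_mul_left _ (V b) (Real.exp_pos (-Φ' * b)).ne']
  ring
end

section
/- Let q > 0, r > 0, δ ∈ ℝ, reals 0 < Φ < Φ′, c, c′ ∈ (0,∞), and a < 0. Let W : ℝ → ℝ be nonnegative, Borel measurable, vanish on (−∞,0), satisfy W(z) ≤ c·e^{Φz} for all z ≥ 0 and ∫₀^∞ e^{−Φ′z}W(z)dz = 1/r. Let V : ℝ → ℝ be nonnegative, vanish on (−∞,0), locally integrable, with x ↦ e^{−Φ′x}·V(x) nondecreasing on (0,∞) converging to c′. Set W̄(x):=∫₀ˣW, Z(x):=1+q·W̄(x), Z̄(x):=∫₀ˣZ, V̄(x):=∫₀ˣV, Z_V(x):=1+(q+r)·V̄(x), Z̄_V(x):=∫₀ˣZ_V, Z(x,Φ′):=e^{Φ′x}(1−r∫₀ˣ e^{−Φ′z}W(z)dz), l(x):=Z̄(x)−δ·W̄(x), and M_a f(x):=f(x−a)+r∫₀ˣ V(x−y)f(y−a)dy. Assume the representation M_aZ̄(x) = Z̄_V(x−a) − r∫₀^{−a} V(x−u−a)·Z̄(u)du holds for all x ≥ 0. Then lim_{b→∞} [M_a l(b) −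 r·l(−a)·V̄(b)] / V(b) = (1/Φ′)·( [r·Z(−a) + q·Z(−a,Φ′)]/Φ′ − δ·Z(−a,Φ′) ). -/
open MeasureTheory Filter Set

/-- Measurable functions of at most exponential growth with rate `Φ`. -/
def ExpGrowth (Φ : ℝ) (f : ℝ → ℝ) : Prop :=
  Measurable f ∧ ∃ C, 0 ≤ C ∧ ∀ y, |f y| ≤ C * Real.exp (Φ * |y|)

lemma ExpGrowth.ii {Φ : ℝ} {f : ℝ → ℝ} (h : ExpGrowth Φ f) (x y : ℝ) :
    IntervalIntegrable f volume x y := by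
  obtain ⟨hm, C, hC, hb⟩ := h
  have hc : Continuous (fun y : ℝ => C * Real.exp (Φ * |y|)) := by fun_prop
  refine (hc.intervalIntegrable x y).mono_fun hm.aestronglyMeasurable ?_
  refine Eventually.of_forall fun t => ?_
  simp only [Real.norm_eq_abs]
  exact (hb t).trans (le_abs_self _)

lemma ExpGrowth.prim_cont {Φ : ℝ} {f : ℝ → ℝ} (h : ExpGrowth Φ f) :
    Continuous (fun x => ∫ t in (0:ℝ)..x, f t) :=
  intervalIntegral.continuous_primitive (fun x y => h.ii x y) 0

lemma expGrowth_prim_aux {Φ C : ℝ} (hΦ : 0 < Φ) (hC : 0 ≤ C) {f : ℝ → ℝ}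
    (hb : ∀ y, |f y| ≤ C * Real.exp (Φ * |y|)) {x : ℝ} (hx : 0 ≤ x) :
    |∫ t in (0:ℝ)..x, f t| ≤ (C / Φ) * Real.exp (Φ * |x|) := by
  have h1 : ‖∫ t in (0:ℝ)..x, f t‖ ≤ ∫ t in (0:ℝ)..x, C * Real.exp (Φ * t) := by
    apply intervalIntegral.norm_integral_le_of_norm_le hx
    · refine Eventually.of_forall fun t ht => ?_
      have := hb t
      rwa [abs_of_pos ht.1] at this
    · apply Continuous.intervalIntegrable
      fun_prop
  have h2 : ∫ t in (0:ℝ)..x, C * Real.exp (Φ * t) = C / Φ * Real.exp (Φ * x) - C / Φ := by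
    rw [intervalIntegral.integral_eq_sub_of_hasDerivAt (f := fun t => C / Φ * Real.exp (Φ * t))]
    · simp
    · intro t _
      have := (((hasDerivAt_id t).const_mul Φ).exp).const_mul (C / Φ)
      have e : C / Φ * (Real.exp (Φ * id t) * (Φ * 1)) = C * Real.exp (Φ * t) := by
        simp only [id]
        field_simp
      rw [e] at this
      exact this
    · apply Continuous.intervalIntegrable
      fun_prop
  rw [h2] at h1
  rw [abs_of_nonneg hx]
  have : 0 ≤ C / Φ := by positivity
  rw [Real.norm_eq_abs] at h1
  linarith

lemma ExpGrowth.prim {Φ : ℝ} (hΦ : 0 < Φ) {f : ℝ → ℝ} (h : ExpGrowth Φ f) :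
    ExpGrowth Φ (fun x => ∫ t in (0:ℝ)..x, f t) := by
  refine ⟨h.prim_cont.measurable, ?_⟩
  obtain ⟨hm, C, hC, hb⟩ := h
  refine ⟨C / Φ, by positivity, fun x => ?_⟩
  rcases le_total 0 x with hx | hx
  · exact expGrowth_prim_aux hΦ hC hb hx
  · have h1 := expGrowth_prim_aux hΦ hC (f := fun t => f (-t))
      (fun y => by simpa using hb (-y)) (x := -x) (by linarith)
    rw [intervalIntegral.integral_comp_neg, intervalIntegral.integral_symm] at h1
    simpa using h1

lemma ExpGrowth.add {Φ : ℝ} {f g : ℝ → ℝ} (hf : ExpGrowth Φ f) (hg : ExpGrowth Φ g) :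
    ExpGrowth Φ (fun x => f x + g x) := by
  obtain ⟨hm, C, hC, hb⟩ := hf
  obtain ⟨hm', C', hC', hb'⟩ := hg
  refine ⟨hm.add hm', C + C', by positivity, fun y => ?_⟩
  have := abs_add_le (f y) (g y)
  have := hb y
  have := hb' y
  linarith

lemma ExpGrowth.smul {Φ : ℝ} {f : ℝ → ℝ} (k : ℝ) (hf : ExpGrowth Φ f) :
    ExpGrowth Φ (fun x => k * f x) := by
  obtain ⟨hm, C, hC, hb⟩ := hf
  refine ⟨hm.const_mul k, |k| * C, by positivity, fun y => ?_⟩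
  rw [abs_mul, mul_assoc]
  exact mul_le_mul_of_nonneg_left (hb y) (abs_nonneg k)

lemma ExpGrowth.const {Φ : ℝ} (hΦ : 0 < Φ) (k : ℝ) : ExpGrowth Φ (fun _ => k) := by
  refine ⟨measurable_const, |k|, abs_nonneg k, fun y => ?_⟩
  have : 1 ≤ Real.exp (Φ * |y|) := Real.one_le_exp (by positivity)
  nlinarith [abs_nonneg k]

lemma ExpGrowth.shift {Φ : ℝ} (hΦ : 0 < Φ) {f : ℝ → ℝ} (A : ℝ) (hf : ExpGrowth Φ f) :
    ExpGrowth Φ (fun x => f (x + A)) := by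
  obtain ⟨hm, C, hC, hb⟩ := hf
  refine ⟨hm.comp (measurable_id.add_const A), C * Real.exp (Φ * |A|), by positivity, fun y => ?_⟩
  refine (hb _).trans ?_
  rw [mul_assoc, ← Real.exp_add]
  have := abs_add_le y A
  have : Φ * |y + A| ≤ Φ * |A| + Φ * |y| := by nlinarith
  gcongr

lemma ExpGrowth.integrable {Φ Φ' : ℝ} (hΦΦ' : Φ < Φ') {f : ℝ → ℝ} (hf : ExpGrowth Φ f) :
    IntegrableOn (fun y => Real.exp (-Φ' * y) * f y) (Ioi 0) := by
  obtain ⟨hm, C, hC, hb⟩ := hf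
  have h1 := (integrableOn_exp_mul_Ioi (a := Φ - Φ') (by linarith) 0).const_mul C
  refine Integrable.mono' h1 ?_ ?_
  · exact ((by fun_prop : Measurable fun y : ℝ => Real.exp (-Φ' * y)).mul hm).aestronglyMeasurable
  · filter_upwards [ae_restrict_mem measurableSet_Ioi] with y hy
    have h2 := hb y
    rw [abs_of_pos (show 0 < y from hy)] at h2
    rw [Real.norm_eq_abs, abs_mul, Real.abs_exp]
    calc _ ≤ Real.exp (-Φ' * y) * (C * Real.exp (Φ * y)) := by gcongr
      _ = C * (Real.exp (-Φ' * y) * Real.exp (Φ * y)) := by ring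
      _ = _ := by rw [← Real.exp_add]; ring_nf

lemma ExpGrowth.tendsto_zero {Φ Φ' : ℝ} (hΦΦ' : Φ < Φ') {f : ℝ → ℝ} (hf : ExpGrowth Φ f) :
    Tendsto (fun y => Real.exp (-Φ' * y) * f y) atTop (nhds 0) := by
  obtain ⟨hm, C, hC, hb⟩ := hf
  have h0 : Tendsto (fun y : ℝ => C * Real.exp ((Φ - Φ') * y)) atTop (nhds 0) := by
    have : Tendsto (fun y : ℝ => (Φ - Φ') * y) atTop atBot :=
      tendsto_id.const_mul_atTop_of_neg (by linarith)
    simpa using (Real.tendsto_exp_atBot.comp this).const_mul C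
  refine squeeze_zero_norm' ?_ h0
  filter_upwards [eventually_gt_atTop 0] with y hy
  have h2 := hb y
  rw [abs_of_pos hy] at h2
  rw [Real.norm_eq_abs, abs_mul, Real.abs_exp]
  calc _ ≤ Real.exp (-Φ' * y) * (C * Real.exp (Φ * y)) := by gcongr
    _ = C * (Real.exp (-Φ' * y) * Real.exp (Φ * y)) := by ring
    _ = _ := by rw [← Real.exp_add]; ring_nf

lemma ExpGrowth.laplace_prim {Φ Φ' : ℝ} (hΦ : 0 < Φ) (hΦΦ' : Φ < Φ') {f : ℝ → ℝ}
    (hf : ExpGrowth Φ f) :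
    ∫ y in Ioi (0:ℝ), Real.exp (-Φ' * y) * ∫ t in (0:ℝ)..y, f t
      = (∫ y in Ioi (0:ℝ), Real.exp (-Φ' * y) * f y) / Φ' := by
  have h1 := hf.integrable hΦΦ'
  have h2 := integrableOn_exp_mul_Ioi (a := -Φ') (by linarith) 0
  have h3 := integral_posConvolution h1 h2 (ContinuousLinearMap.mul ℝ ℝ)
  rw [integral_exp_mul_Ioi (by linarith)] at h3
  simp only [ContinuousLinearMap.mul_apply'] at h3
  rw [show (∫ y in Ioi (0:ℝ), Real.exp (-Φ' * y) * f y) / Φ' =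
    (∫ y in Ioi (0:ℝ), Real.exp (-Φ' * y) * f y) * (-Real.exp (-Φ' * 0) / -Φ') by
      simp [div_eq_mul_inv], ← h3]
  congr 1
  ext y
  rw [← intervalIntegral.integral_const_mul]
  congr 1
  ext t
  rw [mul_right_comm, ← Real.exp_add]
  ring_nf

lemma dom_conv {Φ Φ' c' : ℝ} (hΦΦ' : Φ < Φ') {V G : ℝ → ℝ}
    (hVnn : ∀ x, 0 ≤ V x)
    (hVli : LocallyIntegrable V volume)
    (hVmono : MonotoneOn (fun x => Real.exp (-Φ' * x) * V x) (Set.Ioi 0))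
    (hVlim : Tendsto (fun x => Real.exp (-Φ' * x) * V x) atTop (nhds c'))
    (hG : ExpGrowth Φ G) :
    Tendsto (fun b => Real.exp (-Φ' * b) * ∫ y in (0:ℝ)..b, V (b - y) * G y) atTop
      (nhds (c' * ∫ y in Ioi (0:ℝ), Real.exp (-Φ' * y) * G y)) := by
  set v : ℝ → ℝ := fun x => Real.exp (-Φ' * x) * V x with hv
  have hvle : ∀ x, 0 < x → v x ≤ c' := fun x hx => by
    refine ge_of_tendsto hVlim ?_
    filter_upwards [eventually_ge_atTop x] with z hz
    exact hVmono hx (lt_of_lt_of_le hx hz) hz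
  have hvnn : ∀ x, 0 ≤ v x := fun x => mul_nonneg (Real.exp_pos _).le (hVnn x)
  have hvm : AEStronglyMeasurable v volume :=
    (by fun_prop : Continuous fun x : ℝ => Real.exp (-Φ' * x)).aestronglyMeasurable.mul
      hVli.aestronglyMeasurable
  have hGi := hG.integrable hΦΦ'
  rw [← integral_const_mul]
  have key : Tendsto (fun b => ∫ y in Ioi (0:ℝ),
      (Iio b).indicator (fun y => v (b - y) * (Real.exp (-Φ' * y) * G y)) y) atTop
      (nhds (∫ y in Ioi (0:ℝ), c' * (Real.exp (-Φ' * y) * G y))) := by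
    refine tendsto_integral_filter_of_dominated_convergence
      (fun y => c' * ‖Real.exp (-Φ' * y) * G y‖) ?_ ?_ (hGi.norm.const_mul c') ?_
    · refine Eventually.of_forall fun b => ?_
      refine AEStronglyMeasurable.indicator ?_ measurableSet_Iio
      refine AEStronglyMeasurable.mul ?_ hGi.aestronglyMeasurable
      exact (hvm.comp_measurePreserving
        (Measure.measurePreserving_sub_left volume b)).restrict
    · refine Eventually.of_forall fun b => Eventually.of_forall fun y => ?_
      by_cases hy : y < b
      · rw [indicator_of_mem (show y ∈ Iio b from hy), norm_mul, Real.norm_eq_abs (v _),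
          abs_of_nonneg (hvnn _)]
        exact mul_le_mul_of_nonneg_right (hvle _ (by linarith)) (norm_nonneg _)
      · rw [indicator_of_notMem (show y ∉ Iio b from hy), norm_zero]
        have : 0 ≤ c' := (hvnn 1).trans (hvle 1 one_pos)
        positivity
    · refine Eventually.of_forall fun y => ?_
      have h1 : Tendsto (fun b => v (b - y) * (Real.exp (-Φ' * y) * G y)) atTop
          (nhds (c' * (Real.exp (-Φ' * y) * G y))) := by
        refine Tendsto.mul_const _ (hVlim.comp ?_)
        exact tendsto_atTop_add_const_right _ (-y) tendsto_id
      refine h1.congr' ?_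
      filter_upwards [eventually_gt_atTop y] with b hb
      rw [indicator_of_mem (show y ∈ Iio b from hb)]
  refine key.congr' ?_
  filter_upwards [eventually_ge_atTop 0] with b hb
  rw [setIntegral_indicator measurableSet_Iio, Ioi_inter_Iio, ← integral_Ioc_eq_integral_Ioo,
    ← intervalIntegral.integral_of_le hb, ← intervalIntegral.integral_const_mul]
  congr 1
  ext y
  simp only [hv]
  rw [show -Φ' * b = -Φ' * (b - y) + -Φ' * y by ring, Real.exp_add]
  ring

lemma laplace_shift {Φ Φ' A : ℝ} (hΦΦ' : Φ < Φ') (hA : 0 ≤ A) {W : ℝ → ℝ} (hW : ExpGrowth Φ W) :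
    ∫ y in Ioi (0:ℝ), Real.exp (-Φ' * y) * W (y + A)
      = Real.exp (Φ' * A) * ((∫ y in Ioi (0:ℝ), Real.exp (-Φ' * y) * W y)
        - ∫ y in (0:ℝ)..A, Real.exp (-Φ' * y) * W y) := by
  have hi := hW.integrable hΦΦ'
  rw [← intervalIntegral.integral_interval_add_Ioi hi (hi.mono_set (Ioi_subset_Ioi hA)),
    add_sub_cancel_left, ← integral_const_mul]
  have := (measurePreserving_add_right volume A).setIntegral_preimage_emb
    (MeasurableEquiv.addRight A).measurableEmbedding
    (fun z => Real.exp (Φ' * A) * (Real.exp (-Φ' * z) * W z)) (Ioi A)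
  rw [← this]
  simp only [preimage_add_const_Ioi, sub_self]
  congr 1
  ext y
  rw [← mul_assoc, ← Real.exp_add]
  ring_nf

/-- Lemma B.3(iii), convergence of `K_a^{(q,r)}(b)/W^{(q+r)}(b)` as `b → ∞`. -/
theorem stmt_12 (q r δ Φ Φ' c c' a : ℝ) (hq : 0 < q) (hr : 0 < r)
    (hΦ : 0 < Φ) (hΦΦ' : Φ < Φ') (hc : 0 < c) (hc' : 0 < c') (ha : a < 0)
    (W V : ℝ → ℝ) (hWnn : ∀ x, 0 ≤ W x) (hWm : Measurable W) (hW0 : ∀ x < 0, W x = 0)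
    (hWbound : ∀ z ≥ (0:ℝ), W z ≤ c * Real.exp (Φ * z))
    (hWlap : (∫ z in Set.Ioi (0:ℝ), Real.exp (-Φ' * z) * W z) = 1 / r)
    (hVnn : ∀ x, 0 ≤ V x) (hV0 : ∀ x < 0, V x = 0)
    (hVli : LocallyIntegrable V volume)
    (hVmono : MonotoneOn (fun x => Real.exp (-Φ' * x) * V x) (Set.Ioi 0))
    (hVlim : Tendsto (fun x => Real.exp (-Φ' * x) * V x) atTop (nhds c'))
    (Wbar Z Zbar Vbar ZV ZVbar ZΦ' l : ℝ → ℝ)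
    (hWbar : ∀ x, Wbar x = ∫ y in (0:ℝ)..x, W y)
    (hZ : ∀ x, Z x = 1 + q * Wbar x)
    (hZbar : ∀ x, Zbar x = ∫ y in (0:ℝ)..x, Z y)
    (hVbar : ∀ x, Vbar x = ∫ y in (0:ℝ)..x, V y)
    (hZV : ∀ x, ZV x = 1 + (q + r) * Vbar x)
    (hZVbar : ∀ x, ZVbar x = ∫ y in (0:ℝ)..x, ZV y)
    (hZΦ' : ∀ x, ZΦ' x
      = Real.exp (Φ' * x) * (1 - r * ∫ z in (0:ℝ)..x, Real.exp (-Φ' * z) * W z))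
    (hl : ∀ x, l x = Zbar x - δ * Wbar x)
    (hrep : ∀ x ≥ (0:ℝ),
      Zbar (x - a) + r * ∫ y in (0:ℝ)..x, V (x - y) * Zbar (y - a)
        = ZVbar (x - a) - r * ∫ u in (0:ℝ)..(-a), V (x - u - a) * Zbar u) :
    Tendsto (fun b => ((l (b - a) + r * ∫ y in (0:ℝ)..b, V (b - y) * l (y - a))
        - r * l (-a) * Vbar b) / V b)
      atTop
      (nhds ((1 / Φ') * ((r * Z (-a) + q * ZΦ' (-a)) / Φ' - δ * ZΦ' (-a)))) := by
  obtain ⟨A, rfl⟩ : ∃ A, a = -A := ⟨-a, by ring⟩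
  have hA : 0 < A := by linarith
  simp only [neg_neg, sub_neg_eq_add]
  have hΦ'0 : 0 < Φ' := hΦ.trans hΦΦ'
  have gW : ExpGrowth Φ W := by
    refine ⟨hWm, c, hc.le, fun y => ?_⟩
    rw [abs_of_nonneg (hWnn y)]
    rcases lt_or_ge y 0 with hy | hy
    · rw [hW0 y hy]; positivity
    · rw [abs_of_nonneg hy]; exact hWbound y hy
  obtain rfl : Wbar = fun x => ∫ y in (0:ℝ)..x, W y := funext hWbar
  obtain rfl : Z = _ := funext hZ
  obtain rfl : Zbar = _ := funext hZbar
  have gWb := gW.prim hΦ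
  have gZ := (ExpGrowth.const hΦ 1).add (gWb.smul q)
  have gWA := gW.shift hΦ A
  have gf := (gZ.shift hΦ A).add (gWA.smul (-δ))
  have gG := gf.prim hΦ
  have hG : ∀ y, l (y + A) = l A + ∫ t in (0:ℝ)..y,
      ((1 + q * ∫ s in (0:ℝ)..(t + A), W s) + -δ * W (t + A)) := by
    intro y
    rw [intervalIntegral.integral_add ((gZ.shift hΦ A).ii _ _) ((gWA.smul (-δ)).ii _ _),
      intervalIntegral.integral_const_mul, intervalIntegral.integral_comp_add_right W,
      intervalIntegral.integral_comp_add_right (fun t => 1 + q * ∫ s in (0:ℝ)..t, W s), hl, hl]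
    simp only [zero_add]
    have e1 := intervalIntegral.integral_add_adjacent_intervals (gZ.ii 0 A) (gZ.ii A (y + A))
    have e2 := intervalIntegral.integral_add_adjacent_intervals (gW.ii 0 A) (gW.ii A (y + A))
    rw [← e1, ← e2]
    ring
  set G : ℝ → ℝ := fun y => ∫ t in (0:ℝ)..y,
      ((1 + q * ∫ s in (0:ℝ)..(t + A), W s) + -δ * W (t + A)) with hGdef
  set J := ∫ y in Ioi (0:ℝ), Real.exp (-Φ' * y) * W (y + A) with hJ
  have hrJ : r * J = ZΦ' A := by
    rw [hJ, laplace_shift hΦΦ' hA.le gW, hWlap, hZΦ']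
    field_simp
  -- value of the Laplace transform of `G`
  have hI : ∫ y in Ioi (0:ℝ), Real.exp (-Φ' * y) * G y
      = (((1 + q * ∫ s in (0:ℝ)..A, W s) / Φ' + q * (J / Φ')) - δ * J) / Φ' := by
    rw [gf.laplace_prim hΦ hΦΦ']
    congr 1
    have hsplit : ∀ y, Real.exp (-Φ' * y) *
        ((1 + q * ∫ s in (0:ℝ)..(y + A), W s) + -δ * W (y + A))
        = (Real.exp (-Φ' * y) * (1 + q * ∫ s in (0:ℝ)..A, W s)
          + q * (Real.exp (-Φ' * y) * ∫ s in (0:ℝ)..y, W (s + A)))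
          + -δ * (Real.exp (-Φ' * y) * W (y + A)) := by
      intro y
      rw [intervalIntegral.integral_comp_add_right W, zero_add,
        ← intervalIntegral.integral_add_adjacent_intervals (gW.ii 0 A) (gW.ii A (y + A))]
      ring
    simp only [hsplit]
    have i1 := (ExpGrowth.const hΦ (1 + q * ∫ s in (0:ℝ)..A, W s)).integrable hΦΦ'
    have i2 := ((gWA.prim hΦ).integrable hΦΦ').const_mul q
    have i3 := (gWA.integrable hΦΦ').const_mul (-δ)
    have i12 : Integrable (fun y => Real.exp (-Φ' * y) * (1 + q * ∫ s in (0:ℝ)..A, W s)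
          + q * (Real.exp (-Φ' * y) * ∫ s in (0:ℝ)..y, W (s + A)))
          (volume.restrict (Ioi (0:ℝ))) := i1.add i2
    rw [integral_add i12 i3, integral_add i1 i2, integral_const_mul, integral_const_mul,
      gWA.laplace_prim hΦ hΦΦ', integral_mul_const, integral_exp_mul_Ioi (by linarith), ← hJ,
      mul_zero, Real.exp_zero]
    ring
  have hD := dom_conv hΦΦ' hVnn hVli hVmono hVlim gG
  rw [hI] at hD
  have hT := ((ExpGrowth.const hΦ (l A)).add gG).tendsto_zero hΦΦ'
  have hfin := (hT.add (hD.const_mul r)).div hVlim hc'.ne'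
  refine (hfin.congr fun b => ?_).trans_eq ?_
  · have hVii : IntervalIntegrable (fun y => V (b - y)) volume 0 b := by
      have := (intervalIntegrable_iff.2 ((hVli.integrableOn_isCompact
        (isCompact_uIcc (a := b - 0) (b := b - b))).mono_set uIoc_subset_uIcc)).comp_sub_left b
      simpa using this
    have e1 : ∫ y in (0:ℝ)..b, V (b - y) * l (y + A)
        = l A * Vbar b + ∫ y in (0:ℝ)..b, V (b - y) * G y := by
      rw [hVbar, show ∫ y in (0:ℝ)..b, V y = ∫ y in (0:ℝ)..b, V (b - y) by
        rw [intervalIntegral.integral_comp_sub_left]; simp,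
        ← intervalIntegral.integral_const_mul, ← intervalIntegral.integral_add
          (hVii.const_mul _) (hVii.mul_continuousOn gf.prim_cont.continuousOn)]
      congr 1
      ext y
      rw [hG y]
      ring
    simp only [Pi.div_apply]
    rw [e1, hG b, ← mul_div_mul_left _ (V b) (Real.exp_pos (-Φ' * b)).ne']
    congr 1
    simp only [hGdef]
    ring
  · congr 1
    rw [← hrJ]
    field_simp
    ring
end
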